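/- arXiv:1004.3986 — 2 statements merged into one kernel-verified Lean document; each statement's English description precedes it below -/
import Mathlib

section
/- Let 0 < β < 1 and λ > 0. If g : [0,∞) → ℝ is continuously differentiable with |g(t)| and |g'(t)| of at most exponential growth, then the Riemann–Liouville tempered fractional derivative ∂^{β,λ}g(t) := e^{-λt}(1/Γ(1-β)) d/dt ∫₀^t e^{λs} g(s)(t-s)^{-β} ds − λ^β g(t) has Laplace transform ((s+λ)^β − λ^β) ĝ(s), where ĝ(s) = ∫₀^∞ e^{-st} g(t) dt, for all sufficiently large s. -/
open MeasureTheory Real Set intervalIntegral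

/-- The un-normalised Riemann–Liouville fractional integral of order `1 - β`. -/
noncomputable def abelIntegral (β : ℝ) (h : ℝ → ℝ) (u : ℝ) : ℝ :=
  ∫ v in (0:ℝ)..u, h v * (u - v) ^ (-β)

/-- The Abel integral after rescaling to the unit interval. -/
noncomputable def abelAverage (β : ℝ) (h : ℝ → ℝ) (u : ℝ) : ℝ :=
  ∫ x in (0:ℝ)..1, h (u - u * x) * x ^ (-β)

lemma abelIntegral_eq_rpow_mul_abelAverage {β : ℝ} (hβ1 : β < 1) (h : ℝ → ℝ) {u : ℝ}
    (hu : 0 ≤ u) : abelIntegral β h u = u ^ (1 - β) * abelAverage β h u := by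
  rcases hu.eq_or_lt with rfl | hu
  · simp [abelIntegral, zero_rpow (by linarith : 1 - β ≠ 0)]
  · have key := integral_comp_sub_mul (a := 0) (b := 1)
      (fun v => h v * (u - v) ^ (-β)) hu.ne' u
    simp only [mul_one, sub_self, mul_zero, sub_zero, smul_eq_mul] at key
    have e : ∫ x in (0:ℝ)..1, h (u - u * x) * (u - (u - u * x)) ^ (-β)
        = u ^ (-β) * abelAverage β h u := by
      rw [abelAverage, ← intervalIntegral.integral_const_mul]
      refine integral_congr fun x hx => ?_
      rw [uIcc_of_le zero_le_one] at hx
      simp only [sub_sub_cancel]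
      rw [mul_rpow hu.le hx.1]
      ring
    rw [e] at key
    rw [abelIntegral, sub_eq_add_neg, rpow_add hu, rpow_one, mul_assoc, key,
      mul_inv_cancel_left₀ hu.ne']

lemma abs_integral_mul_rpow_neg_le {β K : ℝ} (hβ1 : β < 1) {φ : ℝ → ℝ}
    (hφ : ∀ x ∈ Ioc (0:ℝ) 1, |φ x| ≤ K) :
    |∫ x in (0:ℝ)..1, φ x * x ^ (-β)| ≤ K / (1 - β) := by
  have hi : ∫ x in (0:ℝ)..1, K * x ^ (-β) = K / (1 - β) := by
    rw [intervalIntegral.integral_const_mul, integral_rpow (Or.inl (by linarith)), one_rpow,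
      zero_rpow (by linarith), neg_add_eq_sub, sub_zero, mul_one_div]
  rw [← hi, ← norm_eq_abs]
  refine norm_integral_le_of_norm_le zero_le_one (Filter.Eventually.of_forall fun x hx => ?_)
    ((intervalIntegrable_rpow' (by linarith)).const_mul K)
  rw [norm_mul, norm_eq_abs, norm_eq_abs, abs_of_nonneg (rpow_nonneg hx.1.le _)]
  exact mul_le_mul_of_nonneg_right (hφ x hx) (rpow_nonneg hx.1.le _)

lemma abs_apply_sub_mul_le {h : ℝ → ℝ} {M b : ℝ} (hb : 0 ≤ b)
    (hM : ∀ v ≥ (0:ℝ), |h v| ≤ M * exp (b * v)) {u x : ℝ} (hu : 0 ≤ u) (hx : x ∈ Ioc (0:ℝ) 1) :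
    |h (u - u * x)| ≤ M * exp (b * u) := by
  have hM0 : 0 ≤ M := by simpa using (abs_nonneg _).trans (hM 0 le_rfl)
  have h1 : u * x ≤ u := mul_le_of_le_one_right hu hx.2
  have h2 : 0 ≤ u * x := mul_nonneg hu hx.1.le
  refine (hM _ (by linarith)).trans ?_
  gcongr
  linarith

lemma abs_abelAverage_le {β M b : ℝ} (hβ1 : β < 1) {h : ℝ → ℝ} (hb : 0 ≤ b)
    (hM : ∀ v ≥ (0:ℝ), |h v| ≤ M * exp (b * v)) {u : ℝ} (hu : 0 ≤ u) :
    |abelAverage β h u| ≤ M * exp (b * u) / (1 - β) :=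
  abs_integral_mul_rpow_neg_le hβ1 fun _ hx => abs_apply_sub_mul_le hb hM hu hx

lemma abs_apply_sub_mul_one_sub_le {h : ℝ → ℝ} {M b : ℝ} (hb : 0 ≤ b)
    (hM : ∀ v ≥ (0:ℝ), |h v| ≤ M * exp (b * v)) {u x : ℝ} (hu : 0 ≤ u) (hx : x ∈ Ioc (0:ℝ) 1) :
    |h (u - u * x) * (1 - x)| ≤ M * exp (b * u) := by
  rw [abs_mul, abs_of_nonneg (by linarith [hx.2] : 0 ≤ 1 - x)]
  exact (mul_le_of_le_one_right (abs_nonneg _) (by linarith [hx.1])).trans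
    (abs_apply_sub_mul_le hb hM hu hx)

lemma hasDerivAt_abelAverage {β M b : ℝ} (hβ1 : β < 1) {h : ℝ → ℝ} (hh : ContDiff ℝ 1 h)
    (hb : 0 ≤ b) (hM : ∀ v ≥ (0:ℝ), |deriv h v| ≤ M * exp (b * v)) {u : ℝ} (hu : 0 < u) :
    HasDerivAt (abelAverage β h)
      (∫ x in (0:ℝ)..1, deriv h (u - u * x) * (1 - x) * x ^ (-β)) u := by
  have hM0 : 0 ≤ M := by simpa using (abs_nonneg _).trans (hM 0 le_rfl)
  have hr : IntervalIntegrable (fun x : ℝ => x ^ (-β)) volume 0 1 :=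
    intervalIntegrable_rpow' (by linarith)
  have hc := hh.continuous
  have hc' := hh.continuous_deriv le_rfl
  have hm : Measurable fun x : ℝ => x ^ (-β) := by fun_prop
  refine (hasDerivAt_integral_of_dominated_loc_of_deriv_le (s := Ioo 0 (2 * u))
    (F := fun u x => h (u - u * x) * x ^ (-β))
    (F' := fun u x => deriv h (u - u * x) * (1 - x) * x ^ (-β))
    (bound := fun x => M * exp (b * (2 * u)) * x ^ (-β))
    (Ioo_mem_nhds hu (by linarith)) (Filter.Eventually.of_forall fun y => ?_) ?_ ?_
    (Filter.Eventually.of_forall fun x hx y hy => ?_) (hr.const_mul _)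
    (Filter.Eventually.of_forall fun x hx y hy => ?_)).2
  · exact (Measurable.mul (Continuous.measurable (by fun_prop)) hm).aestronglyMeasurable
  · exact hr.continuousOn_mul (by fun_prop)
  · exact (Measurable.mul (Continuous.measurable (by fun_prop)) hm).aestronglyMeasurable
  · rw [uIoc_of_le zero_le_one] at hx
    rw [norm_mul, norm_eq_abs, norm_eq_abs, abs_of_nonneg (rpow_nonneg hx.1.le _)]
    refine mul_le_mul_of_nonneg_right ((abs_apply_sub_mul_one_sub_le hb hM hy.1.le hx).trans ?_)
      (rpow_nonneg hx.1.le _)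
    have := hy.2.le
    gcongr
  · have h1 : HasDerivAt (fun y : ℝ => y - y * x) (1 - x) y := by
      exact ((hasDerivAt_id y).sub ((hasDerivAt_id y).mul_const x)).congr_deriv (by ring)
    exact ((hh.differentiable one_ne_zero _).hasDerivAt.comp y h1).mul_const _

lemma integrableOn_of_abs_le_rpow_mul_exp {f : ℝ → ℝ} {K r c : ℝ} (hr : -1 < r) (hc : 0 < c)
    (hf : AEStronglyMeasurable f (volume.restrict (Ioi 0)))
    (hK : ∀ t ∈ Ioi (0:ℝ), |f t| ≤ K * (t ^ r * exp (-c * t))) : IntegrableOn f (Ioi 0) := by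
  have h := (integrableOn_rpow_mul_exp_neg_mul_rpow hr zero_lt_one hc).const_mul K
  simp only [rpow_one] at h
  exact h.mono' hf ((ae_restrict_iff' measurableSet_Ioi).2 (Filter.Eventually.of_forall hK))

lemma integral_exp_mul_abelIntegral {β p : ℝ} (hβ1 : β < 1) {h : ℝ → ℝ} (hp : 0 < p)
    (hi : IntegrableOn (fun t => exp (-p * t) * h t) (Ioi 0)) :
    ∫ t in Ioi (0:ℝ), exp (-p * t) * abelIntegral β h t
      = (∫ t in Ioi (0:ℝ), exp (-p * t) * h t) * (p ^ (β - 1) * Gamma (1 - β)) := by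
  have hk : IntegrableOn (fun t : ℝ => t ^ (-β) * exp (-p * t)) (Ioi 0) := by
    simpa using integrableOn_rpow_mul_exp_neg_mul_rpow (by linarith : -1 < -β) zero_lt_one hp
  have hkv : ∫ t in Ioi (0:ℝ), t ^ (-β) * exp (-p * t) = p ^ (β - 1) * Gamma (1 - β) := by
    have := integral_rpow_mul_exp_neg_mul_Ioi (by linarith : 0 < 1 - β) hp
    rw [one_div, inv_rpow hp.le, ← rpow_neg hp.le, neg_sub] at this
    simpa using this
  have key := integral_posConvolution hi hk (ContinuousLinearMap.mul ℝ ℝ)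
  simp only [ContinuousLinearMap.mul_apply'] at key
  rw [hkv] at key
  rw [← key]
  congr with t
  rw [abelIntegral, ← intervalIntegral.integral_const_mul]
  congr with v
  rw [show -p * t = -p * v + -p * (t - v) by ring, exp_add]
  ring

lemma hasDerivAt_abelIntegral {β M b : ℝ} (hβ1 : β < 1) {h : ℝ → ℝ} (hh : ContDiff ℝ 1 h)
    (hb : 0 ≤ b) (hM : ∀ v ≥ (0:ℝ), |deriv h v| ≤ M * exp (b * v)) {u : ℝ} (hu : 0 < u) :
    HasDerivAt (abelIntegral β h)
      ((1 - β) * u ^ (-β) * abelAverage β h u +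
        u ^ (1 - β) * ∫ x in (0:ℝ)..1, deriv h (u - u * x) * (1 - x) * x ^ (-β)) u := by
  have h1 := hasDerivAt_rpow_const (x := u) (p := 1 - β) (Or.inl hu.ne')
  rw [sub_sub_cancel_left] at h1
  refine (h1.mul (hasDerivAt_abelAverage hβ1 hh hb hM hu)).congr_of_eventuallyEq ?_
  filter_upwards [Ioi_mem_nhds hu] with y hy
  exact abelIntegral_eq_rpow_mul_abelAverage hβ1 h (le_of_lt hy)

lemma abs_abelIntegral_le {β M b : ℝ} (hβ1 : β < 1) {h : ℝ → ℝ} (hb : 0 ≤ b)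
    (hM : ∀ v ≥ (0:ℝ), |h v| ≤ M * exp (b * v)) {u : ℝ} (hu : 0 ≤ u) :
    |abelIntegral β h u| ≤ M / (1 - β) * (u ^ (1 - β) * exp (b * u)) := by
  rw [abelIntegral_eq_rpow_mul_abelAverage hβ1 h hu, abs_mul, abs_of_nonneg (rpow_nonneg hu _)]
  refine (mul_le_mul_of_nonneg_left (abs_abelAverage_le hβ1 hb hM hu)
    (rpow_nonneg hu _)).trans_eq ?_
  ring

lemma abs_deriv_abelIntegral_le {β M b : ℝ} (hβ1 : β < 1) {h : ℝ → ℝ} (hh : ContDiff ℝ 1 h)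
    (hb : 0 ≤ b) (hM : ∀ v ≥ (0:ℝ), |h v| ≤ M * exp (b * v))
    (hM' : ∀ v ≥ (0:ℝ), |deriv h v| ≤ M * exp (b * v)) {u : ℝ} (hu : 0 < u) :
    |deriv (abelIntegral β h) u| ≤
      M * (u ^ (-β) * exp (b * u)) + M / (1 - β) * (u ^ (1 - β) * exp (b * u)) := by
  have hβ : 0 < 1 - β := by linarith
  rw [(hasDerivAt_abelIntegral hβ1 hh hb hM' hu).deriv]
  refine (abs_add_le _ _).trans (add_le_add ?_ ?_)
  · rw [abs_mul, abs_of_nonneg (by positivity)]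
    refine (mul_le_mul_of_nonneg_left (abs_abelAverage_le hβ1 hb hM hu.le)
      (by positivity)).trans_eq ?_
    field_simp
  · rw [abs_mul, abs_of_nonneg (by positivity)]
    refine (mul_le_mul_of_nonneg_left (abs_integral_mul_rpow_neg_le hβ1
      fun x hx => abs_apply_sub_mul_one_sub_le hb hM' hu.le hx) (by positivity)).trans_eq ?_
    ring

lemma exp_neg_mul_mul_exp (p b t : ℝ) : exp (-p * t) * exp (b * t) = exp (-(p - b) * t) := by
  rw [← exp_add]; ring_nf

lemma integrableOn_exp_mul_of_abs_le {h : ℝ → ℝ} (hh : Continuous h) {M b p : ℝ}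
    (hM : ∀ v ≥ (0:ℝ), |h v| ≤ M * exp (b * v)) (hp : b < p) :
    IntegrableOn (fun t => exp (-p * t) * h t) (Ioi 0) := by
  refine integrableOn_of_abs_le_rpow_mul_exp (K := M) (r := 0) (c := p - b) (by norm_num)
    (by linarith) (Continuous.aestronglyMeasurable (by fun_prop)) fun t ht => ?_
  rw [abs_mul, abs_exp, rpow_zero, one_mul, ← exp_neg_mul_mul_exp, mul_left_comm]
  exact mul_le_mul_of_nonneg_left (hM t (le_of_lt ht)) (exp_pos _).le

/-- The Laplace transform of the derivative of the Abel integral. -/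
lemma laplace_deriv_abelIntegral {β M b p : ℝ} (hβ1 : β < 1) {h : ℝ → ℝ}
    (hh : ContDiff ℝ 1 h) (hb : 0 ≤ b) (hM : ∀ v ≥ (0:ℝ), |h v| ≤ M * exp (b * v))
    (hM' : ∀ v ≥ (0:ℝ), |deriv h v| ≤ M * exp (b * v)) (hp : b < p) :
    IntegrableOn (fun t => exp (-p * t) * deriv (abelIntegral β h) t) (Ioi 0) ∧
    ∫ t in Ioi (0:ℝ), exp (-p * t) * deriv (abelIntegral β h) t
      = p ^ β * Gamma (1 - β) * ∫ t in Ioi (0:ℝ), exp (-p * t) * h t := by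
  have hp0 : 0 < p := hb.trans_lt hp
  have hc : 0 < p - b := by linarith
  have hβ : 0 < 1 - β := by linarith
  have hd : ∀ t ∈ Ioi (0:ℝ), HasDerivAt (abelIntegral β h) (deriv (abelIntegral β h) t) t :=
    fun t ht => (hasDerivAt_abelIntegral hβ1 hh hb hM' ht).differentiableAt.hasDerivAt
  have habs : ∀ t ∈ Ioi (0:ℝ), |exp (-p * t) * abelIntegral β h t| ≤
      M / (1 - β) * (t ^ (1 - β) * exp (-(p - b) * t)) := fun t ht => by
    rw [abs_mul, abs_exp]
    refine (mul_le_mul_of_nonneg_left (abs_abelIntegral_le hβ1 hb hM (le_of_lt ht))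
      (exp_pos _).le).trans_eq ?_
    rw [← exp_neg_mul_mul_exp]
    ring
  have hF : IntegrableOn (fun t => exp (-p * t) * abelIntegral β h t) (Ioi 0) := by
    refine integrableOn_of_abs_le_rpow_mul_exp (by linarith) hc ?_ habs
    refine ContinuousOn.aestronglyMeasurable (ContinuousOn.mul (by fun_prop) ?_) measurableSet_Ioi
    exact fun t ht => (hd t ht).continuousAt.continuousWithinAt
  have hF' : IntegrableOn (fun t => exp (-p * t) * deriv (abelIntegral β h) t) (Ioi 0) := by
    have i1 := (integrableOn_rpow_mul_exp_neg_mul_rpow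
      (by linarith : -1 < -β) zero_lt_one hc).const_mul M
    have i2 := (integrableOn_rpow_mul_exp_neg_mul_rpow
      (by linarith : -1 < 1 - β) zero_lt_one hc).const_mul (M / (1 - β))
    simp only [rpow_one] at i1 i2
    refine (i1.add i2).mono' ?_ ((ae_restrict_iff' measurableSet_Ioi).2
      (Filter.Eventually.of_forall fun t ht => ?_))
    · exact (Measurable.mul (Continuous.measurable (by fun_prop))
        (measurable_deriv _)).aestronglyMeasurable
    · rw [norm_mul, norm_eq_abs, norm_eq_abs, abs_exp]
      refine (mul_le_mul_of_nonneg_left (abs_deriv_abelIntegral_le hβ1 hh hb hM hM' ht)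
        (exp_pos _).le).trans_eq ?_
      simp only [Pi.add_apply]
      rw [← exp_neg_mul_mul_exp]
      ring
  refine ⟨hF', ?_⟩
  have h0 : abelIntegral β h 0 = 0 := by simp [abelIntegral]
  have hcont : ContinuousWithinAt (fun t => exp (-p * t) * abelIntegral β h t) (Ici 0) 0 := by
    refine ContinuousWithinAt.mul (Continuous.continuousWithinAt (by fun_prop)) ?_
    rw [ContinuousWithinAt, h0]
    refine squeeze_zero_norm' (a := fun u => M / (1 - β) * (u ^ (1 - β) * exp (b * u))) ?_ ?_
    · filter_upwards [self_mem_nhdsWithin] with u hu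
      exact abs_abelIntegral_le hβ1 hb hM hu
    · have hk : Continuous fun u : ℝ => M / (1 - β) * (u ^ (1 - β) * exp (b * u)) :=
        continuous_const.mul ((continuous_rpow_const hβ.le).mul (by fun_prop))
      simpa [zero_rpow hβ.ne'] using (hk.tendsto 0).mono_left nhdsWithin_le_nhds
  have hlim : Filter.Tendsto (fun t => exp (-p * t) * abelIntegral β h t) Filter.atTop
      (nhds 0) := by
    refine squeeze_zero_norm'
      (a := fun t => M / (1 - β) * (t ^ (1 - β) * exp (-(p - b) * t))) ?_ ?_
    · filter_upwards [Filter.Ioi_mem_atTop 0] with t ht using habs t ht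
    · simpa using (tendsto_rpow_mul_exp_neg_mul_atTop_nhds_zero (1 - β) (p - b) hc).const_mul
        (M / (1 - β))
  have key := integral_Ioi_of_hasDerivAt_of_tendsto hcont
    (f' := fun t => exp (-p * t) * deriv (abelIntegral β h) t -
      p * (exp (-p * t) * abelIntegral β h t))
    (fun t ht => by
      have he : HasDerivAt (fun t : ℝ => exp (-p * t)) (exp (-p * t) * -p) t := by
        simpa using ((hasDerivAt_id t).const_mul (-p)).exp
      exact (he.mul (hd t ht)).congr_deriv (by ring))
    (hF'.sub (hF.const_mul p)) hlim
  rw [integral_sub hF' (hF.const_mul p), MeasureTheory.integral_const_mul, h0, mul_zero, sub_zero,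
    integral_exp_mul_abelIntegral hβ1 hp0
      (integrableOn_exp_mul_of_abs_le hh.continuous hM hp), sub_eq_zero] at key
  rw [key, rpow_sub_one hp0.ne']
  field_simp

theorem laplace_transform_RL_tempered_derivative (β lam : ℝ) (hβ0 : 0 < β) (hβ1 : β < 1)
    (hlam : 0 < lam) (g : ℝ → ℝ)
    (hg : ContDiff ℝ 1 g)
    (hgrow : ∃ C a : ℝ, ∀ t ≥ (0:ℝ), |g t| ≤ C * Real.exp (a * t))
    (hgrow' : ∃ C a : ℝ, ∀ t ≥ (0:ℝ), |deriv g t| ≤ C * Real.exp (a * t)) :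
    ∃ s₀ : ℝ, ∀ s > s₀,
      ∫ t in Set.Ioi (0:ℝ), Real.exp (-s * t) *
          (Real.exp (-lam * t) * (1 / Real.Gamma (1 - β)) *
            deriv (fun u => ∫ v in (0:ℝ)..u, Real.exp (lam * v) * g v * (u - v) ^ (-β)) t
          - lam ^ β * g t)
      = ((s + lam) ^ β - lam ^ β) * ∫ t in Set.Ioi (0:ℝ), Real.exp (-s * t) * g t := by
  obtain ⟨C₁, a₁, h₁⟩ := hgrow
  obtain ⟨C₂, a₂, h₂⟩ := hgrow'
  have hC₁ : 0 ≤ C₁ := by simpa using (abs_nonneg _).trans (h₁ 0 le_rfl)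
  have hC₂ : 0 ≤ C₂ := by simpa using (abs_nonneg _).trans (h₂ 0 le_rfl)
  set a := max (max a₁ a₂) 0
  have ha₁ : a₁ ≤ a := (le_max_left _ _).trans (le_max_left _ _)
  have ha₂ : a₂ ≤ a := (le_max_right _ _).trans (le_max_left _ _)
  have ha : 0 ≤ a := le_max_right _ _
  have hg1 : ∀ t ≥ (0:ℝ), |g t| ≤ C₁ * exp (a * t) := fun t ht => (h₁ t ht).trans (by gcongr)
  have hg2 : ∀ t ≥ (0:ℝ), |deriv g t| ≤ C₂ * exp (a * t) := fun t ht => (h₂ t ht).trans (by gcongr)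
  set h : ℝ → ℝ := fun v => exp (lam * v) * g v with hdef
  have hh : ContDiff ℝ 1 h := by fun_prop
  set M := (1 + lam) * C₁ + C₂
  have hsplit : ∀ v, exp ((a + lam) * v) = exp (lam * v) * exp (a * v) := fun v => by
    rw [← exp_add]; ring_nf
  have hM : ∀ v ≥ (0:ℝ), |h v| ≤ M * exp ((a + lam) * v) := fun v hv => by
    rw [hsplit, hdef, abs_mul, abs_exp, mul_left_comm]
    refine mul_le_mul_of_nonneg_left ((hg1 v hv).trans ?_) (exp_pos _).le
    gcongr
    nlinarith [mul_nonneg hlam.le hC₁]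
  have hM' : ∀ v ≥ (0:ℝ), |deriv h v| ≤ M * exp ((a + lam) * v) := fun v hv => by
    have he : HasDerivAt (fun v : ℝ => exp (lam * v)) (exp (lam * v) * lam) v := by
      simpa using ((hasDerivAt_id v).const_mul lam).exp
    have hd : deriv h v = exp (lam * v) * (lam * g v + deriv g v) := by
      have hm : HasDerivAt h _ v := he.mul (hg.differentiable one_ne_zero v).hasDerivAt
      rw [hm.deriv]
      ring
    rw [hd, hsplit, abs_mul, abs_exp, mul_left_comm]
    refine mul_le_mul_of_nonneg_left ((abs_add_le _ _).trans ?_) (exp_pos _).le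
    rw [abs_mul, abs_of_pos hlam]
    nlinarith [mul_le_mul_of_nonneg_left (hg1 v hv) hlam.le, hg2 v hv,
      mul_nonneg hC₁ (exp_pos (a * v)).le]
  refine ⟨a, fun s hs => ?_⟩
  obtain ⟨hi, hv⟩ := laplace_deriv_abelIntegral (p := s + lam) hβ1 hh (by linarith) hM hM'
    (by linarith)
  have hgi := integrableOn_exp_mul_of_abs_le hg.continuous hg1 hs
  have hΓ : Gamma (1 - β) ≠ 0 := (Gamma_pos_of_pos (by linarith)).ne'
  have hhat : ∫ t in Ioi (0:ℝ), exp (-(s + lam) * t) * h t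
      = ∫ t in Ioi (0:ℝ), exp (-s * t) * g t := by
    congr with t
    rw [hdef, ← mul_assoc, ← exp_add]
    ring_nf
  have hint : ∀ t, exp (-s * t) * (exp (-lam * t) * (1 / Gamma (1 - β)) *
        deriv (abelIntegral β h) t - lam ^ β * g t)
      = 1 / Gamma (1 - β) * (exp (-(s + lam) * t) * deriv (abelIntegral β h) t)
        - lam ^ β * (exp (-s * t) * g t) := fun t => by
    rw [show -(s + lam) * t = -s * t + -lam * t by ring, exp_add]
    ring
  change ∫ t in Ioi (0:ℝ), exp (-s * t) * (exp (-lam * t) * (1 / Gamma (1 - β)) *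
        deriv (abelIntegral β h) t - lam ^ β * g t) = _
  simp_rw [hint]
  rw [integral_sub (hi.const_mul _) (hgi.const_mul _), MeasureTheory.integral_const_mul,
    MeasureTheory.integral_const_mul, hv, hhat]
  field_simp
end

section
/- Let λ > 0, 0 < β < 1, and μ > 0. Suppose g : (0,∞) → ℝ is continuous with |g(t)| ≤ 1 and |g'(t)| ≤ μ e^{-λt} t^{β-1} Γ(1-β)/(π sin(βπ)) for t > 0. Then the Riemann–Liouville fractional derivative of t ↦ e^{λt} g(t), namely (1/Γ(1-β)) d/dt ∫₀^t e^{λs} g(s) (t-s)^{-β} ds, exists and equals (1/Γ(1-β)) ∫₀^t (λ e^{λs} g(s) + e^{λs} g'(s)) (t-s)^{-β} ds + g(0) t^{-β}/Γ(1-β), and is a continuous function of t > 0. -/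
open MeasureTheory Real Set intervalIntegral

open Filter Topology

theorem intervalIntegrable_rpow_mul_sub_rpow {β u : ℝ} (hβ0 : 0 < β) (hβ1 : β < 1) (hu : 0 < u) :
    IntervalIntegrable (fun s => s ^ (β - 1) * (u - s) ^ (-β)) volume 0 u := by
  have hmid : 0 < u / 2 := by linarith
  refine IntervalIntegrable.trans (b := u / 2) ?_ ?_
  · refine (intervalIntegrable_rpow' (by linarith)).mul_continuousOn ?_
    refine ContinuousOn.rpow_const (by fun_prop) fun s hs => Or.inl ?_
    rw [uIcc_of_le hmid.le] at hs
    linarith [hs.2]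
  · refine IntervalIntegrable.continuousOn_mul ?_ ?_
    · have h := (intervalIntegrable_rpow' (a := u / 2) (b := 0) (r := -β)
        (by linarith)).comp_sub_left u
      have e : u - u / 2 = u / 2 := by ring
      simpa only [e, sub_zero] using h
    · refine ContinuousOn.rpow_const (by fun_prop) fun s hs => Or.inl ?_
      rw [uIcc_of_le (by linarith)] at hs
      linarith [hs.1]

theorem integral_comp_mul_left_mul_rpow {β u t : ℝ} (hu : 0 < u) (ht : 0 ≤ t) (htu : t ≤ u)
    (k : ℝ → ℝ) :
    ∫ s in (0:ℝ)..t, k s * (u - s) ^ (-β) =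
      u ^ (1 - β) * ∫ σ in (0:ℝ)..(t / u), k (u * σ) * (1 - σ) ^ (-β) := by
  have h := mul_integral_comp_mul_left (a := 0) (b := t / u)
    (f := fun s => k s * (u - s) ^ (-β)) (c := u)
  rw [mul_zero, mul_div_cancel₀ _ hu.ne'] at h
  rw [← h, ← intervalIntegral.integral_const_mul, ← intervalIntegral.integral_const_mul]
  refine integral_congr fun σ hσ => ?_
  rw [uIcc_of_le (by positivity)] at hσ
  have h1 : 0 ≤ 1 - σ := by linarith [hσ.2, (div_le_one hu).2 htu]
  have e : u - u * σ = u * (1 - σ) := by ring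
  have e2 : u ^ (1 - β) = u * u ^ (-β) := by
    rw [sub_eq_add_neg, rpow_add hu, rpow_one]
  rw [e, mul_rpow hu.le h1, e2]
  ring

theorem integral_rpow_mul_sub_rpow {β u t : ℝ} (hu : 0 < u) (ht : 0 ≤ t) (htu : t ≤ u) :
    ∫ s in (0:ℝ)..t, s ^ (β - 1) * (u - s) ^ (-β) =
      ∫ σ in (0:ℝ)..(t / u), σ ^ (β - 1) * (1 - σ) ^ (-β) := by
  rw [integral_comp_mul_left_mul_rpow hu ht htu (fun s => s ^ (β - 1)),
    ← intervalIntegral.integral_const_mul]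
  refine integral_congr fun σ hσ => ?_
  rw [uIcc_of_le (by positivity)] at hσ
  have e : u ^ (1 - β) * u ^ (β - 1) = 1 := by
    rw [← rpow_add hu]; simp
  rw [mul_rpow hu.le hσ.1]
  linear_combination (σ ^ (β - 1) * (1 - σ) ^ (-β)) * e

theorem intervalIntegrable_mul_sub_rpow {β u K : ℝ} (hβ0 : 0 < β) (hβ1 : β < 1) (hu : 0 < u)
    {k : ℝ → ℝ} (hk : Measurable k) (hK : ∀ s ∈ Ioc 0 u, |k s| ≤ K * s ^ (β - 1)) :
    IntervalIntegrable (fun s => k s * (u - s) ^ (-β)) volume 0 u := by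
  refine ((intervalIntegrable_rpow_mul_sub_rpow hβ0 hβ1 hu).const_mul K).mono_fun'
    (by fun_prop) ?_
  rw [uIoc_of_le hu.le]
  refine (ae_restrict_iff' measurableSet_Ioc).2 (ae_of_all _ fun s hs => ?_)
  have h0 : 0 ≤ (u - s) ^ (-β) := rpow_nonneg (by linarith [hs.2]) _
  simp only
  rw [norm_mul, norm_of_nonneg h0, ← mul_assoc, norm_eq_abs]
  exact mul_le_mul_of_nonneg_right (hK s hs) h0

theorem abs_integral_mul_sub_rpow_sub_le {β t u K : ℝ} (hβ0 : 0 < β) (hβ1 : β < 1)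
    (ht : 0 < t) (htu : t ≤ u) {k : ℝ → ℝ} (hk : Measurable k)
    (hK : ∀ s ∈ Ioc 0 u, |k s| ≤ K * s ^ (β - 1)) :
    |(∫ s in (0:ℝ)..u, k s * (u - s) ^ (-β)) - ∫ s in (0:ℝ)..t, k s * (t - s) ^ (-β)| ≤
      2 * K * ((∫ σ in (0:ℝ)..1, σ ^ (β - 1) * (1 - σ) ^ (-β)) -
        ∫ σ in (0:ℝ)..(t / u), σ ^ (β - 1) * (1 - σ) ^ (-β)) := by
  have hu : 0 < u := ht.trans_le htu
  have hKt : ∀ s ∈ Ioc 0 t, |k s| ≤ K * s ^ (β - 1) := fun s hs => hK s ⟨hs.1, hs.2.trans htu⟩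
  have sub0 : uIcc 0 t ⊆ uIcc 0 u := by
    rw [uIcc_of_le ht.le, uIcc_of_le hu.le]; exact Icc_subset_Icc_right htu
  have sub1 : uIcc t u ⊆ uIcc 0 u := by
    rw [uIcc_of_le htu, uIcc_of_le hu.le]; exact Icc_subset_Icc_left ht.le
  have iu := intervalIntegrable_mul_sub_rpow hβ0 hβ1 hu hk hK
  have it := intervalIntegrable_mul_sub_rpow hβ0 hβ1 ht hk hKt
  have wu := intervalIntegrable_rpow_mul_sub_rpow hβ0 hβ1 hu
  have wt := intervalIntegrable_rpow_mul_sub_rpow hβ0 hβ1 ht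
  have su := integral_add_adjacent_intervals (iu.mono_set sub0) (iu.mono_set sub1)
  have swu := integral_add_adjacent_intervals (wu.mono_set sub0) (wu.mono_set sub1)
  have A : ‖∫ s in t..u, k s * (u - s) ^ (-β)‖ ≤
      ∫ s in t..u, K * (s ^ (β - 1) * (u - s) ^ (-β)) := by
    refine norm_integral_le_of_norm_le htu (ae_of_all _ fun s hs => ?_)
      ((wu.mono_set sub1).const_mul K)
    have h0 : 0 ≤ (u - s) ^ (-β) := rpow_nonneg (by linarith [hs.2]) _
    rw [norm_mul, norm_of_nonneg h0, ← mul_assoc, norm_eq_abs]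
    exact mul_le_mul_of_nonneg_right (hK s ⟨ht.trans hs.1, hs.2⟩) h0
  have B : ‖∫ s in (0:ℝ)..t, (k s * (t - s) ^ (-β) - k s * (u - s) ^ (-β))‖ ≤
      ∫ s in (0:ℝ)..t, K * (s ^ (β - 1) * (t - s) ^ (-β) - s ^ (β - 1) * (u - s) ^ (-β)) := by
    refine norm_integral_le_of_norm_le ht.le ?_ ((wt.sub (wu.mono_set sub0)).const_mul K)
    filter_upwards [Measure.ae_ne volume t] with s hst hs
    have hlt : s < t := lt_of_le_of_ne hs.2 hst
    have h0 : 0 ≤ (t - s) ^ (-β) - (u - s) ^ (-β) :=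
      sub_nonneg.2 (rpow_le_rpow_of_nonpos (by linarith) (by linarith) (by linarith))
    rw [← mul_sub, ← mul_sub, norm_mul, norm_of_nonneg h0, ← mul_assoc, norm_eq_abs]
    exact mul_le_mul_of_nonneg_right (hKt s hs) h0
  rw [intervalIntegral.integral_const_mul] at A B
  rw [integral_sub it (iu.mono_set sub0), integral_sub wt (wu.mono_set sub0)] at B
  have e1 := integral_rpow_mul_sub_rpow (β := β) hu hu.le le_rfl
  have e2 := integral_rpow_mul_sub_rpow (β := β) ht ht.le le_rfl
  have e3 := integral_rpow_mul_sub_rpow (β := β) hu ht.le htu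
  rw [div_self hu.ne'] at e1
  rw [div_self ht.ne'] at e2
  rw [norm_eq_abs, abs_le] at A B
  rw [e2, e3] at B
  rw [e1, e3] at swu
  rw [← swu] at B ⊢
  rw [← su, abs_le]
  constructor <;> linarith [A.1, A.2, B.1, B.2]

theorem continuousOn_integral_mul_sub_rpow {β : ℝ} (hβ0 : 0 < β) (hβ1 : β < 1)
    {k : ℝ → ℝ} (hk : Measurable k)
    (hK : ∀ T > 0, ∃ K, ∀ s ∈ Ioc 0 T, |k s| ≤ K * s ^ (β - 1)) :
    ContinuousOn (fun u => ∫ s in (0:ℝ)..u, k s * (u - s) ^ (-β)) (Ioi 0) := by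
  intro t ht
  have ht : 0 < t := ht
  refine ContinuousAt.continuousWithinAt ?_
  obtain ⟨K, hK⟩ := hK (2 * t) (by linarith)
  set J : ℝ → ℝ := fun r => ∫ σ in (0:ℝ)..r, σ ^ (β - 1) * (1 - σ) ^ (-β)
  have hJc : ContinuousOn J (Icc 0 1) := by
    have h := intervalIntegrable_rpow_mul_sub_rpow hβ0 hβ1 zero_lt_one
    have := continuousOn_primitive_interval (a := 0) (b := 1) (μ := volume)
      (f := fun σ : ℝ => σ ^ (β - 1) * (1 - σ) ^ (-β))
      (by rw [uIcc_of_le zero_le_one]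
          exact (intervalIntegrable_iff_integrableOn_Icc_of_le zero_le_one).1 h)
    rwa [uIcc_of_le zero_le_one] at this
  have hr : Tendsto (fun u => min u t / max u t) (𝓝 t) (𝓝[Icc 0 1] 1) := by
    refine tendsto_nhdsWithin_iff.2 ⟨?_, ?_⟩
    · have : ContinuousAt (fun u => min u t / max u t) t :=
        ContinuousAt.div (by fun_prop) (by fun_prop) (by simpa using ht.ne')
      simpa [ContinuousAt, div_self ht.ne'] using this
    · filter_upwards [lt_mem_nhds ht] with u hu
      have hm : 0 < max u t := lt_max_of_lt_right ht
      exact ⟨div_nonneg (le_min hu.le ht.le) hm.le, (div_le_one hm).2 min_le_max⟩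
  have hlim : Tendsto (fun u => 2 * K * (J 1 - J (min u t / max u t))) (𝓝 t) (𝓝 0) := by
    have h := ((hJc 1 ⟨zero_le_one, le_rfl⟩).tendsto.comp hr).const_sub (J 1) |>.const_mul (2 * K)
    simpa using h
  refine tendsto_iff_norm_sub_tendsto_zero.2 (squeeze_zero' (Eventually.of_forall fun _ =>
    norm_nonneg _) ?_ hlim)
  filter_upwards [lt_mem_nhds ht, gt_mem_nhds (show t < 2 * t by linarith)] with u hu hu2
  rw [norm_eq_abs]
  rcases le_total t u with h | h
  · rw [min_eq_right h, max_eq_left h]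
    exact abs_integral_mul_sub_rpow_sub_le hβ0 hβ1 ht h hk
      fun s hs => hK s ⟨hs.1, hs.2.trans hu2.le⟩
  · rw [min_eq_left h, max_eq_right h, abs_sub_comm]
    exact abs_integral_mul_sub_rpow_sub_le hβ0 hβ1 hu h hk
      fun s hs => hK s ⟨hs.1, hs.2.trans (by linarith)⟩

theorem hasDerivAt_integral_mul_sub_rpow {β t : ℝ} (hβ0 : 0 < β) (hβ1 : β < 1) (ht : 0 < t)
    {f : ℝ → ℝ} (hfc : ContinuousOn f (Ici 0)) (hfd : ∀ s > 0, DifferentiableAt ℝ f s)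
    (hK : ∀ T > 0, ∃ K, ∀ s ∈ Ioc 0 T, |deriv f s| ≤ K * s ^ (β - 1)) :
    HasDerivAt (fun u => ∫ s in (0:ℝ)..u, f s * (u - s) ^ (-β))
      ((∫ s in (0:ℝ)..t, deriv f s * (t - s) ^ (-β)) + f 0 * t ^ (-β)) t := by
  obtain ⟨K, hK⟩ := hK (2 * t) (by linarith)
  have hK0 : 0 ≤ K := by
    have h := (abs_nonneg _).trans (hK t ⟨ht, by linarith⟩)
    exact nonneg_of_mul_nonneg_left h (rpow_pos_of_pos ht _)
  have hw := intervalIntegrable_rpow_mul_sub_rpow hβ0 hβ1 zero_lt_one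
  have hker : IntervalIntegrable (fun σ : ℝ => (1 - σ) ^ (-β)) volume 0 1 := by
    have h := (intervalIntegrable_rpow' (a := 1) (b := 0) (r := -β) (by linarith)).comp_sub_left 1
    simpa using h
  have hcomp : ∀ u > 0, ContinuousOn (fun σ => f (u * σ)) (uIcc 0 1) := fun u hu => by
    refine hfc.comp (by fun_prop) fun σ hσ => ?_
    rw [uIcc_of_le zero_le_one] at hσ
    exact mul_nonneg hu.le hσ.1
  have hint : ∀ u > 0, IntervalIntegrable (fun σ => f (u * σ) * (1 - σ) ^ (-β)) volume 0 1 :=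
    fun u hu => hker.continuousOn_mul (hcomp u hu)
  have hmd := measurable_deriv f
  obtain ⟨hF'int, hF'⟩ := hasDerivAt_integral_of_dominated_loc_of_deriv_le (μ := volume)
    (F := fun u σ => f (u * σ) * (1 - σ) ^ (-β))
    (F' := fun u σ => deriv f (u * σ) * σ * (1 - σ) ^ (-β)) (x₀ := t)
    (s := Ioo (t / 2) (2 * t)) (a := 0) (b := 1)
    (bound := fun σ => K * (t / 2) ^ (β - 1) * (σ ^ (β - 1) * (1 - σ) ^ (-β)))
    (Ioo_mem_nhds (by linarith) (by linarith))
    (by filter_upwards [lt_mem_nhds ht] with u hu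
        exact (hint u hu).aestronglyMeasurable_restrict_uIoc)
    (hint t ht) (by fun_prop)
    (by
      refine ae_of_all _ fun σ hσ u hu => ?_
      rw [uIoc_of_le zero_le_one] at hσ
      have hu0 : 0 < u := by linarith [hu.1]
      have h0 : 0 ≤ (1 - σ) ^ (-β) := rpow_nonneg (by linarith [hσ.2]) _
      have h1 : |deriv f (u * σ)| ≤ K * (u * σ) ^ (β - 1) :=
        hK _ ⟨mul_pos hu0 hσ.1, by nlinarith [hσ.1, hσ.2, hu.2]⟩
      have h2 : u ^ (β - 1) ≤ (t / 2) ^ (β - 1) :=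
        rpow_le_rpow_of_nonpos (by linarith) hu.1.le (by linarith)
      rw [mul_rpow hu0.le hσ.1.le] at h1
      have h3 : 0 ≤ σ ^ (β - 1) := rpow_nonneg hσ.1.le _
      rw [norm_mul, norm_mul, norm_of_nonneg h0, norm_of_nonneg hσ.1.le, norm_eq_abs, ← mul_assoc]
      refine mul_le_mul_of_nonneg_right ?_ h0
      calc |deriv f (u * σ)| * σ ≤ |deriv f (u * σ)| :=
            mul_le_of_le_one_right (abs_nonneg _) hσ.2
        _ ≤ K * (u ^ (β - 1) * σ ^ (β - 1)) := h1
        _ ≤ K * ((t / 2) ^ (β - 1) * σ ^ (β - 1)) := by gcongr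
        _ = _ := by ring)
    (hw.const_mul _)
    (by
      refine ae_of_all _ fun σ hσ u hu => ?_
      rw [uIoc_of_le zero_le_one] at hσ
      have hpos : 0 < u * σ := mul_pos (by linarith [hu.1]) hσ.1
      have h := ((hfd _ hpos).hasDerivAt.comp u ((hasDerivAt_id u).mul_const σ)).mul_const
        ((1 - σ) ^ (-β))
      simpa [Function.comp_def] using! h)
  have hH : IntervalIntegrable (fun σ => deriv f (t * σ) * (1 - σ) ^ (-β)) volume 0 1 := by
    refine intervalIntegrable_mul_sub_rpow (K := K * t ^ (β - 1)) (k := fun σ => deriv f (t * σ))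
      hβ0 hβ1 zero_lt_one (by fun_prop) fun σ hσ => ?_
    have h := hK (t * σ) ⟨mul_pos ht hσ.1, by nlinarith [hσ.1, hσ.2]⟩
    rwa [mul_rpow ht.le hσ.1.le, ← mul_assoc] at h
  have hparts : ∫ σ in (0:ℝ)..1, (t * (deriv f (t * σ) * (1 - σ) ^ (-β))
      - t * (deriv f (t * σ) * σ * (1 - σ) ^ (-β))
      - (1 - β) * (f (t * σ) * (1 - σ) ^ (-β))) = - f 0 := by
    rw [integral_eq_sub_of_hasDerivAt_of_le (f := fun σ => f (t * σ) * (1 - σ) ^ (1 - β))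
      zero_le_one]
    · simp [zero_rpow (show 1 - β ≠ 0 by linarith)]
    · have h := hcomp t ht
      rw [uIcc_of_le zero_le_one] at h
      exact h.mul (ContinuousOn.rpow_const (by fun_prop) fun σ _ => Or.inr (by linarith))
    · intro σ hσ
      have h1 : 0 < 1 - σ := by linarith [hσ.2]
      have hpos : 0 < t * σ := mul_pos ht hσ.1
      have hd := (hfd _ hpos).hasDerivAt.comp σ ((hasDerivAt_id σ).const_mul t)
      have hd2 := ((hasDerivAt_id σ).const_sub 1).rpow_const (p := 1 - β) (Or.inl h1.ne')
      have hd3 := hd.mul hd2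
      have e : (1 - σ) ^ (1 - β) = (1 - σ) * (1 - σ) ^ (-β) := by
        rw [sub_eq_add_neg 1 β, rpow_add h1, rpow_one]
      have e2 : 1 - β - 1 = -β := by ring
      refine hd3.congr_deriv ?_
      simp only [id, Function.comp_apply, e, e2]
      ring
    · exact ((hH.const_mul t).sub (hF'int.const_mul t)).sub ((hint t ht).const_mul (1 - β))
  rw [integral_sub ((hH.const_mul t).sub (hF'int.const_mul t)) ((hint t ht).const_mul (1 - β)),
    integral_sub (hH.const_mul t) (hF'int.const_mul t), intervalIntegral.integral_const_mul,
    intervalIntegral.integral_const_mul, intervalIntegral.integral_const_mul] at hparts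
  have hprod := (hasDerivAt_rpow_const (x := t) (p := 1 - β) (Or.inl ht.ne')).mul hF'
  have e3 : t ^ (1 - β) = t * t ^ (-β) := by
    rw [sub_eq_add_neg 1 β, rpow_add ht, rpow_one]
  refine (hprod.congr_deriv ?_).congr_of_eventuallyEq ?_
  · rw [integral_comp_mul_left_mul_rpow ht ht.le le_rfl, div_self ht.ne', e3,
      show 1 - β - 1 = -β by ring]
    linear_combination (-t ^ (-β)) * hparts
  · filter_upwards [lt_mem_nhds ht] with u hu
    rw [integral_comp_mul_left_mul_rpow hu hu.le le_rfl, div_self hu.ne']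
    rfl

theorem RL_derivative_of_exponentially_tempered (β lam μ : ℝ)
    (hβ0 : 0 < β) (hβ1 : β < 1) (hlam : 0 < lam) (hμ : 0 < μ)
    (g : ℝ → ℝ)
    (hgc : ContinuousOn g (Set.Ici 0))
    (hgd : ∀ t > (0:ℝ), DifferentiableAt ℝ g t)
    (hgb : ∀ t > (0:ℝ), |g t| ≤ 1)
    (hg'b : ∀ t > (0:ℝ), |deriv g t| ≤
      μ * Real.exp (-lam * t) * t ^ (β - 1) * Real.Gamma (1 - β) /
        (Real.pi * Real.sin (β * Real.pi))) :
    (∀ t > (0:ℝ),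
      DifferentiableAt ℝ
        (fun u => ∫ s in (0:ℝ)..u, Real.exp (lam * s) * g s * (u - s) ^ (-β)) t
      ∧ (1 / Real.Gamma (1 - β)) *
          deriv (fun u => ∫ s in (0:ℝ)..u, Real.exp (lam * s) * g s * (u - s) ^ (-β)) t
        = (1 / Real.Gamma (1 - β)) *
            (∫ s in (0:ℝ)..t,
              (lam * Real.exp (lam * s) * g s + Real.exp (lam * s) * deriv g s) *
                (t - s) ^ (-β))
          + g 0 * t ^ (-β) / Real.Gamma (1 - β))
    ∧ ContinuousOn
        (fun t => (1 / Real.Gamma (1 - β)) *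
          deriv (fun u => ∫ s in (0:ℝ)..u, Real.exp (lam * s) * g s * (u - s) ^ (-β)) t)
        (Set.Ioi 0) := by
  set f : ℝ → ℝ := fun s => Real.exp (lam * s) * g s with hf
  set C := μ * Real.Gamma (1 - β) / (Real.pi * Real.sin (β * Real.pi)) with hC
  have hder : ∀ s > (0:ℝ), HasDerivAt f
      (lam * Real.exp (lam * s) * g s + Real.exp (lam * s) * deriv g s) s := fun s hs => by
    have h := (((hasDerivAt_id s).const_mul lam).exp).mul (hgd s hs).hasDerivAt
    refine h.congr_deriv ?_
    simp only [id]
    ring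
  have hfc : ContinuousOn f (Ici 0) := ContinuousOn.mul (by fun_prop) hgc
  have hfd : ∀ s > (0:ℝ), DifferentiableAt ℝ f s := fun s hs => (hder s hs).differentiableAt
  have hK : ∀ T > (0:ℝ), ∃ K, ∀ s ∈ Ioc 0 T, |deriv f s| ≤ K * s ^ (β - 1) := by
    intro T hT
    refine ⟨lam * Real.exp (lam * T) * T ^ (1 - β) + C, fun s hs => ?_⟩
    rw [(hder s hs.1).deriv]
    have hs0 : 0 < s := hs.1
    have h1 : |lam * Real.exp (lam * s) * g s| ≤ lam * Real.exp (lam * T) * 1 := by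
      rw [abs_mul, abs_of_pos (by positivity)]
      gcongr
      · exact hs.2
      · exact hgb s hs0
    have h2 : 1 ≤ T ^ (1 - β) * s ^ (β - 1) := by
      have e : s ^ (1 - β) * s ^ (β - 1) = 1 := by
        rw [← rpow_add hs0]; simp
      exact e.symm.le.trans (mul_le_mul_of_nonneg_right
        (rpow_le_rpow hs0.le hs.2 (by linarith)) (rpow_nonneg hs0.le _))
    have h3 : |Real.exp (lam * s) * deriv g s| ≤ C * s ^ (β - 1) := by
      rw [abs_mul, abs_of_pos (Real.exp_pos _)]
      refine (mul_le_mul_of_nonneg_left (hg'b s hs0) (Real.exp_pos _).le).trans_eq ?_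
      have e : Real.exp (lam * s) * Real.exp (-lam * s) = 1 := by
        rw [← Real.exp_add]; simp
      rw [hC]
      linear_combination (μ * s ^ (β - 1) * Real.Gamma (1 - β) /
        (Real.pi * Real.sin (β * Real.pi))) * e
    have h4 : lam * Real.exp (lam * T) * 1 ≤
        lam * Real.exp (lam * T) * (T ^ (1 - β) * s ^ (β - 1)) := by gcongr
    refine (abs_add_le _ _).trans ?_
    linarith
  have hmain : ∀ t > (0:ℝ), HasDerivAt (fun u => ∫ s in (0:ℝ)..u, f s * (u - s) ^ (-β))
      ((∫ s in (0:ℝ)..t, deriv f s * (t - s) ^ (-β)) + f 0 * t ^ (-β)) t :=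
    fun t ht => hasDerivAt_integral_mul_sub_rpow hβ0 hβ1 ht hfc hfd hK
  refine ⟨fun t ht => ⟨(hmain t ht).differentiableAt, ?_⟩, ?_⟩
  · rw [(hmain t ht).deriv]
    have e : ∫ s in (0:ℝ)..t, deriv f s * (t - s) ^ (-β) = ∫ s in (0:ℝ)..t,
        (lam * Real.exp (lam * s) * g s + Real.exp (lam * s) * deriv g s) * (t - s) ^ (-β) := by
      rw [integral_of_le ht.le, integral_of_le ht.le]
      refine setIntegral_congr_fun measurableSet_Ioc fun s hs => ?_
      simp only [(hder s hs.1).deriv]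
    have e0 : f 0 = g 0 := by simp [hf]
    rw [e, e0]
    ring
  · have hcont := continuousOn_integral_mul_sub_rpow hβ0 hβ1 (measurable_deriv f) hK
    refine ContinuousOn.congr (f := fun t => (1 / Real.Gamma (1 - β)) *
      ((∫ s in (0:ℝ)..t, deriv f s * (t - s) ^ (-β)) + f 0 * t ^ (-β))) ?_ ?_
    · refine continuousOn_const.mul (hcont.add (continuousOn_const.mul ?_))
      exact ContinuousOn.rpow_const continuousOn_id fun t ht => Or.inl (ne_of_gt ht)
    · intro t ht
      simp only
      rw [(hmain t ht).deriv]
end
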